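/- Let d ≥ 2 be an integer and let G ≤ Sym(Ω) be a finite permutation group of degree n = |Ω| with n ≥ 2 such that G lies in the class Γ_d. Then |G| < d^{n-1}. -/

import Mathlib

open scoped Pointwise

/-- A group `H` has a *section* isomorphic to the alternating group `A_d`, i.e. there are
subgroups `K ⊴ L ≤ H` with `L/K ≅ A_d`; equivalently, there is a subgroup `L ≤ H` and a
surjective homomorphism from `L` onto `A_d`. -/
def HasAltSection (d : ℕ) (H : Type*) [Group H] : Prop :=
  ∃ (L : Subgroup H) (φ : ↥L →* alternatingGroup (Fin d)), Function.Surjective φ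

/-- The class `Γ_d`: groups with no section isomorphic to the alternating group `A_d`. -/
def InGamma (d : ℕ) (H : Type*) [Group H] : Prop := ¬ HasAltSection d H

/-- A permutation group `G ≤ Sym(Ω)` is primitive if it acts transitively on `Ω` and
every block of the action is trivial (i.e. it preserves no nontrivial partition of `Ω`). -/
def IsPrimitivePerm {Ω : Type*} (G : Subgroup (Equiv.Perm Ω)) : Prop :=
  MulAction.IsPretransitive G Ω ∧
    ∀ B : Set Ω, MulAction.IsBlock G B → MulAction.IsTrivialBlock B

/-- `G ≤ Sym(Ω)` has a base of size at most `k`: a subset of `Ω` of cardinality at most `k`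
whose pointwise stabilizer in `G` is trivial.  The base size `b(G)` is the least such `k`,
so `b(G) ≤ k` is expressed by `HasBaseOfSize G k`. -/
def HasBaseOfSize {Ω : Type*} (G : Subgroup (Equiv.Perm Ω)) (k : ℕ) : Prop :=
  ∃ S : Finset Ω, S.card ≤ k ∧ ∀ g ∈ G, (∀ α ∈ S, g α = α) → g = 1

/-- The pointwise stabilizer `G_(Δ) = ⋂_{α ∈ Δ} G_α` of a subset `Δ ⊆ Ω` in `G ≤ Sym(Ω)`,
as a subgroup of `G` (equal to `G` itself when `Δ` is empty). -/
def PointwiseStab {Ω : Type*} (G : Subgroup (Equiv.Perm Ω)) (Δ : Finset Ω) : Subgroup ↥G :=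
  ⨅ α ∈ Δ, MulAction.stabilizer (↥G) α

open MulAction

/-! ### The class `Γ_d` -/

theorem InGamma.of_injective {d : ℕ} {G H : Type*} [Group G] [Group H] (hG : InGamma d G)
    (f : H →* G) (hf : Function.Injective f) : InGamma d H := by
  rintro ⟨L, φ, hφ⟩
  exact hG ⟨L.map f, φ.comp (L.equivMapOfInjective f hf).symm.toMonoidHom,
    hφ.comp (L.equivMapOfInjective f hf).symm.surjective⟩

theorem InGamma.subgroup {d : ℕ} {G : Type*} [Group G] (hG : InGamma d G) (H : Subgroup G) :
    InGamma d H :=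
  hG.of_injective H.subtype H.subtype_injective

theorem InGamma.of_surjective {d : ℕ} {G H : Type*} [Group G] [Group H] (hG : InGamma d G)
    (f : G →* H) (hf : Function.Surjective f) : InGamma d H := by
  rintro ⟨L, φ, hφ⟩
  refine hG ⟨L.comap f, φ.comp (f.subgroupComap L), hφ.comp ?_⟩
  rintro ⟨x, hx⟩
  obtain ⟨g, rfl⟩ := hf x
  exact ⟨⟨g, hx⟩, rfl⟩

theorem InGamma.range {d : ℕ} {G H : Type*} [Group G] [Group H] (hG : InGamma d G)
    (f : G →* H) : InGamma d f.range :=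
  hG.of_surjective f.rangeRestrict f.rangeRestrict_surjective

theorem not_inGamma_two (G : Type*) [Group G] : ¬ InGamma 2 G := fun h =>
  h ⟨⊤, 1, fun x => ⟨1, by
    have : Nat.card (alternatingGroup (Fin 2)) = 1 := by
      have := nat_card_alternatingGroup (α := Fin 2); simp at this; simpa using this
    have := (Nat.card_eq_one_iff_unique.mp this).1
    exact Subsingleton.elim _ _⟩⟩

/-! ### The bound for transitive groups -/

/-- The bound on the order of a transitive group of degree `n` in `Γ_d`. -/
def transBound (d n : ℕ) : ℕ := if n ≤ 1 then 1 else (d - 1) * d ^ (n - 2)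

theorem transBound_of_le_one (d : ℕ) {n : ℕ} (hn : n ≤ 1) : transBound d n = 1 := if_pos hn

theorem transBound_of_two_le (d : ℕ) {n : ℕ} (hn : 2 ≤ n) :
    transBound d n = (d - 1) * d ^ (n - 2) := if_neg (by omega)

theorem transBound_pos {d : ℕ} (hd : 2 ≤ d) (n : ℕ) : 0 < transBound d n := by
  unfold transBound
  split_ifs
  · exact one_pos
  · exact Nat.mul_pos (by omega) (by positivity)

theorem transBound_lt {d n : ℕ} (hd : 2 ≤ d) (hn : 2 ≤ n) : transBound d n < d ^ (n - 1) := by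
  rw [transBound_of_two_le d hn, show n - 1 = (n - 2) + 1 by omega, pow_succ, mul_comm]
  exact Nat.mul_lt_mul_of_pos_left (by omega) (by positivity)

theorem transBound_le {d : ℕ} (hd : 2 ≤ d) (n : ℕ) : transBound d n ≤ d ^ (n - 1) := by
  rcases Nat.lt_or_ge n 2 with h | h
  · rw [transBound_of_le_one d (by omega)]
    exact Nat.one_le_pow _ _ (by omega)
  · exact (transBound_lt hd h).le

theorem mul_transBound_le {d n : ℕ} (hd : 2 ≤ d) (hn : 1 ≤ n) : d * transBound d n ≤ d ^ n := by
  calc d * transBound d n ≤ d * d ^ (n - 1) := Nat.mul_le_mul_left _ (transBound_le hd n)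
    _ = d ^ n := by rw [← pow_succ', Nat.sub_add_cancel hn]

theorem transBound_pow_mul_le {d m k : ℕ} (hd : 2 ≤ d) (hm : 2 ≤ m) (hk : 2 ≤ k) :
    transBound d m ^ k * transBound d k ≤ transBound d (m * k) := by
  have hmk : 2 ≤ m * k := by nlinarith
  calc transBound d m ^ k * transBound d k
      ≤ (d ^ (m - 1)) ^ k * ((d - 1) * d ^ (k - 2)) := by
        rw [transBound_of_two_le d hk]
        gcongr
        exact transBound_le hd m
    _ = (d - 1) * d ^ ((m - 1) * k + (k - 2)) := by rw [← pow_mul, pow_add]; ring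
    _ = transBound d (m * k) := by
        rw [transBound_of_two_le d hmk]
        congr 2
        rw [Nat.sub_mul, one_mul]
        have : 1 * k ≤ m * k := Nat.mul_le_mul_right k (by omega)
        omega

/-- Transitive groups in `Γ_d` of degree less than `n` satisfy the bound `transBound`. -/
def TransitiveBound (d n : ℕ) : Prop :=
  ∀ (X : Type) [Finite X] (G : Subgroup (Equiv.Perm X)), InGamma d G → IsPretransitive G X →
    Nat.card X < n → Nat.card G ≤ transBound d (Nat.card X)

theorem TransitiveBound.card_range_le {d n : ℕ} (h : TransitiveBound d n) {G : Type*} [Group G]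
    (hG : InGamma d G) (X : Type) [Finite X] [MulAction G X] [hX : IsPretransitive G X]
    (hn : Nat.card X < n) : Nat.card (toPermHom G X).range ≤ transBound d (Nat.card X) := by
  refine h X _ (hG.range _) ⟨fun x y => ?_⟩ hn
  obtain ⟨g, hg⟩ := hX.exists_smul_eq x y
  exact ⟨⟨toPermHom G X g, g, rfl⟩, hg⟩

/-! ### Subdirect products and orbits -/

theorem card_le_card_mul_prod_range {G : Type*} [Group G] [Finite G] {ι : Type*} (s : Finset ι)
    {A : ι → Type*} [∀ i, Group (A i)] (f : ∀ i, G →* A i) (K : Subgroup G)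
    (hK : ∀ g, (∀ i ∈ s, f i g = 1) → g ∈ K) :
    Nat.card G ≤ Nat.card K * ∏ i ∈ s, Nat.card (f i).range := by
  let F : G →* (∀ i : s, (f i).range) := MonoidHom.pi fun i => (f i).rangeRestrict
  have hker : F.ker ≤ K := by
    intro g hg
    refine hK g fun i hi => ?_
    have := congrFun (show F g = 1 from hg) ⟨i, hi⟩
    exact congrArg Subtype.val this
  have hfin : ∀ i, Finite (f i).range := fun i => Set.finite_range (f i)
  have h1 : Nat.card F.range ≤ ∏ i ∈ s, Nat.card (f i).range := by
    calc Nat.card F.range ≤ Nat.card (∀ i : s, (f i).range) :=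
          Nat.card_le_card_of_injective _ F.range.subtype_injective
      _ = ∏ i ∈ s, Nat.card (f i).range := by
          rw [Nat.card_pi, Finset.prod_coe_sort s (fun i => Nat.card (f i).range)]
  calc Nat.card G = Nat.card F.ker * Nat.card F.range := by
        rw [← Subgroup.index_ker, Subgroup.card_mul_index]
    _ ≤ _ := Nat.mul_le_mul (Subgroup.card_le_of_le hker) h1

theorem TransitiveBound.card_le_mul_prod_orbits {d n : ℕ} (h : TransitiveBound d n) {G : Type*}
    [Group G] [Finite G] (hG : InGamma d G) {X : Type} [Finite X] [MulAction G X]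
    (S : Finset (orbitRel.Quotient G X)) (hS : ∀ ω ∈ S, Nat.card ω.orbit < n) (K : Subgroup G)
    (hK : ∀ g, (∀ ω ∈ S, ∀ x ∈ ω.orbit, g • x = x) → g ∈ K) :
    Nat.card G ≤ Nat.card K * ∏ ω ∈ S, transBound d (Nat.card ω.orbit) := by
  refine (card_le_card_mul_prod_range S (fun ω => toPermHom G ω.orbit) K fun g hg =>
    hK g fun ω hω x hx => ?_).trans (Nat.mul_le_mul_left _ (Finset.prod_le_prod' fun ω hω => ?_))
  · have := congrArg Subtype.val (DFunLike.congr_fun (hg ω hω) ⟨x, hx⟩)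
    exact this
  · exact h.card_range_le hG _ (hS ω hω)

theorem sum_card_orbit (G X : Type*) [Group G] [Finite X] [MulAction G X]
    [Fintype (orbitRel.Quotient G X)] :
    ∑ ω : orbitRel.Quotient G X, Nat.card ω.orbit = Nat.card X := by
  rw [← Nat.card_sigma]
  exact (Nat.card_congr (selfEquivSigmaOrbits' G X)).symm

theorem one_le_card_orbit {G X : Type*} [Group G] [Finite X] [MulAction G X]
    (ω : orbitRel.Quotient G X) : 1 ≤ Nat.card ω.orbit :=
  have : Nonempty ω.orbit := (orbitRel.Quotient.nonempty_orbit ω).to_subtype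
  Nat.card_pos

/-- The product bound coming from all orbits of a faithful action. -/
theorem TransitiveBound.pow_mul_card_le {d n : ℕ} (hd : 2 ≤ d) (h : TransitiveBound d n)
    {G : Type*} [Group G] [Finite G] (hG : InGamma d G) {X : Type} [Finite X] [MulAction G X]
    [FaithfulSMul G X] (hn : ∀ ω : orbitRel.Quotient G X, Nat.card ω.orbit < n) :
    d ^ Nat.card (orbitRel.Quotient G X) * Nat.card G ≤ d ^ Nat.card X := by
  have := Fintype.ofFinite (orbitRel.Quotient G X)
  have h1 := h.card_le_mul_prod_orbits hG Finset.univ (fun ω _ => hn ω) ⊥ fun g hg => by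
    refine Subgroup.mem_bot.mpr (FaithfulSMul.eq_of_smul_eq_smul (α := X) fun x => ?_)
    rw [one_smul]
    exact hg (Quotient.mk'' x) (Finset.mem_univ _) x (by simp [orbitRel.Quotient.orbit_mk])
  rw [Subgroup.card_bot, one_mul] at h1
  calc d ^ Nat.card (orbitRel.Quotient G X) * Nat.card G
      ≤ d ^ Nat.card (orbitRel.Quotient G X) *
        ∏ ω : orbitRel.Quotient G X, transBound d (Nat.card ω.orbit) := Nat.mul_le_mul_left _ h1
    _ = ∏ ω : orbitRel.Quotient G X, (d * transBound d (Nat.card ω.orbit)) := by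
        rw [Finset.prod_mul_distrib, Finset.prod_const, Finset.card_univ, Nat.card_eq_fintype_card]
    _ ≤ ∏ ω : orbitRel.Quotient G X, d ^ Nat.card ω.orbit :=
        Finset.prod_le_prod' fun ω _ => mul_transBound_le hd (one_le_card_orbit ω)
    _ = d ^ Nat.card X := by rw [Finset.prod_pow_eq_pow_sum, sum_card_orbit]

/-! ### Reduction to primitive groups -/

theorem IsBlock.isPretransitive_stabilizer {G X : Type*} [Group G] [MulAction G X]
    [IsPretransitive G X] {B : Set X} (hB : IsBlock G B) :
    IsPretransitive (stabilizer G B) B := by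
  refine ⟨fun x y => ?_⟩
  have hy : (y : X) ∈ orbit (stabilizer G B) (x : X) := by
    rw [hB.orbit_stabilizer_eq x.2]
    exact y.2
  obtain ⟨g, hg⟩ := hy
  exact ⟨g, Subtype.ext hg⟩

theorem TransitiveBound.card_le_of_isBlock {d : ℕ} (hd : 2 ≤ d) {X : Type} [Finite X]
    {G : Subgroup (Equiv.Perm X)} (hG : InGamma d G) [IsPretransitive G X]
    (h : TransitiveBound d (Nat.card X)) {B : Set X} (hB : IsBlock G B) (hB1 : ¬ B.Subsingleton)
    (hB2 : B ≠ Set.univ) : Nat.card G ≤ transBound d (Nat.card X) := by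
  have hm : 2 ≤ B.ncard := by
    rw [Set.not_subsingleton_iff, ← Set.one_lt_ncard_iff_nontrivial] at hB1
    exact hB1
  have hBne : B.Nonempty := Set.nonempty_of_ncard_ne_zero (by omega)
  have hmk := hB.ncard_block_mul_ncard_orbit_eq hBne
  have hlt : B.ncard < Nat.card X := by
    rw [← Set.ncard_univ]
    exact Set.ncard_lt_ncard (Set.ssubset_univ_iff.mpr hB2)
  have hk : 2 ≤ (orbit G B).ncard := by
    by_contra hk
    interval_cases hk' : (orbit G B).ncard <;> omega
  have hklt : (orbit G B).ncard < Nat.card X := by nlinarith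
  have hrange : Nat.card (toPermHom G (orbit G B)).range ≤ transBound d (orbit G B).ncard := by
    have := h.card_range_le hG (orbit G B) (by rwa [Nat.card_coe_set_eq])
    rwa [Nat.card_coe_set_eq] at this
  set K := (toPermHom G (orbit G B)).ker with hK
  have hstab : ∀ β : orbit G B, K ≤ stabilizer G (β : Set X) := fun β g hg =>
    congrArg Subtype.val (DFunLike.congr_fun (show toPermHom G (orbit G B) g = 1 from hg) β)
  have hker : Nat.card K ≤ transBound d B.ncard ^ (orbit G B).ncard := by
    have := Fintype.ofFinite (orbit G B)
    have h1 := card_le_card_mul_prod_range (Finset.univ : Finset (orbit G B))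
      (fun β => (toPermHom (stabilizer G (β : Set X)) (β : Set X)).comp
        (Subgroup.inclusion (hstab β))) (⊥ : Subgroup K) (fun g hg => by
          refine Subgroup.mem_bot.mpr (Subtype.ext (Subtype.ext (Equiv.ext fun x => ?_)))
          obtain ⟨b, hb⟩ := hBne
          obtain ⟨a, rfl⟩ := exists_smul_eq G b x
          exact congrArg Subtype.val (DFunLike.congr_fun
            (hg ⟨a • B, a, rfl⟩ (Finset.mem_univ _)) ⟨a • b, Set.smul_mem_smul_set hb⟩))
    rw [Subgroup.card_bot, one_mul] at h1
    refine h1.trans ((Finset.prod_le_pow_card _ _ (transBound d B.ncard) fun β _ => ?_).trans ?_)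
    · obtain ⟨_, a, rfl⟩ := β
      have hblock : IsBlock G (a • B) := hB.translate a
      have := IsBlock.isPretransitive_stabilizer hblock
      have hcard : Nat.card (a • B : Set X) = B.ncard := by
        rw [Nat.card_coe_set_eq, Set.ncard_smul_set]
      have h2 := h.card_range_le (hG.subgroup (stabilizer G (a • B))) (a • B : Set X)
        (by rwa [hcard])
      rw [hcard] at h2
      refine (Subgroup.card_le_of_le ?_).trans h2
      rw [MonoidHom.range_comp]
      exact Subgroup.map_le_range _ _
    · rw [Finset.card_univ, ← Nat.card_eq_fintype_card, Nat.card_coe_set_eq]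
  calc Nat.card G = Nat.card K * Nat.card (toPermHom G (orbit G B)).range := by
        rw [hK, ← Subgroup.index_ker, Subgroup.card_mul_index]
    _ ≤ _ := Nat.mul_le_mul hker hrange
    _ ≤ _ := transBound_pow_mul_le hd hm hk
    _ = transBound d (Nat.card X) := by rw [hmk]

theorem transitiveBound_of_preprimitive {d : ℕ} (hd : 2 ≤ d)
    (hprim : ∀ (X : Type) [Finite X] (G : Subgroup (Equiv.Perm X)), InGamma d G →
      IsPreprimitive G X → 2 ≤ Nat.card X → TransitiveBound d (Nat.card X) →
      Nat.card G ≤ transBound d (Nat.card X)) (n : ℕ) : TransitiveBound d n := by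
  induction n with
  | zero => exact fun X _ G _ _ hX => absurd hX (Nat.not_lt_zero _)
  | succ n ih =>
    intro X _ G hG hX hn
    rcases (Nat.lt_succ_iff.mp hn).lt_or_eq with hlt | rfl
    · exact ih X G hG hX hlt
    rcases Nat.lt_or_ge (Nat.card X) 2 with h2 | h2
    · have : Subsingleton X := by
        rw [← Finite.card_le_one_iff_subsingleton]; omega
      rw [transBound_of_le_one d (by omega)]
      exact Finite.card_le_one_iff_subsingleton.mpr inferInstance
    by_cases hP : IsPreprimitive G X
    · exact hprim X G hG hP h2 ih
    · obtain ⟨B, hB, hB'⟩ : ∃ B : Set X, IsBlock G B ∧ ¬ IsTrivialBlock B := by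
        by_contra! hcon
        exact hP { isTrivialBlock_of_isBlock := fun hB => hcon _ hB }
      obtain ⟨hB1, hB2⟩ := not_or.mp hB'
      exact ih.card_le_of_isBlock hd hG hB hB1 hB2

/-! ### Primitive groups for `d ≥ 4` -/

theorem isThreeCycle_commutator {X : Type*} [Fintype X] [DecidableEq X] {u v : Equiv.Perm X}
    {a : X} (hu : u a ≠ a) (hv : v a ≠ a) (h : ∀ x, u x ≠ x → v x ≠ x → x = a) :
    (u * v * u⁻¹ * v⁻¹).IsThreeCycle := by
  have hu' : ∀ x, u⁻¹ (u x) = x := fun x => by simp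
  have hv' : ∀ x, v⁻¹ (v x) = x := fun x => by simp
  have hui := u.injective
  have hvi := v.injective
  have h' : ∀ x, u x = x ∨ v x = x ∨ x = a := fun x => by
    have := h x
    tauto
  rw [← card_support_eq_three_iff]
  have hne : u a ≠ v a := fun he => hu (h (u a) (fun h' => hu (hui h'))
    (fun h' => hv (hvi (he ▸ h'))))
  have hsupp : (u * v * u⁻¹ * v⁻¹).support = {a, u a, v a} := by
    ext x
    simp only [Equiv.Perm.mem_support, Equiv.Perm.mul_apply, Finset.mem_insert,
      Finset.mem_singleton]
    obtain ⟨y, rfl⟩ := v.surjective x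
    rw [hv']
    obtain ⟨z, rfl⟩ := u.surjective y
    rw [hu']
    grind
  rw [hsupp, Finset.card_eq_three]
  exact ⟨a, u a, v a, hu.symm, hv.symm, hne, rfl⟩

theorem not_inGamma_alternatingGroup {d : ℕ} {X : Type*} [Fintype X] [DecidableEq X]
    (hX : d ≤ Nat.card X) : ¬ InGamma d (alternatingGroup X) := by
  intro hG
  obtain ⟨ι⟩ : Nonempty (Fin d ↪ X) :=
    Function.Embedding.nonempty_of_card_le (by simpa [Nat.card_eq_fintype_card] using hX)
  let e := Equiv.ofInjective ι ι.injective
  let f : alternatingGroup (Fin d) →* alternatingGroup X :=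
    ((Equiv.Perm.extendDomainHom e).comp (alternatingGroup (Fin d)).subtype).codRestrict _
      fun g => by
        rw [Equiv.Perm.mem_alternatingGroup]
        exact (Equiv.Perm.sign_extendDomain _ _).trans (Equiv.Perm.mem_alternatingGroup.mp g.2)
  refine (hG.of_injective f fun x y hxy => ?_) ⟨⊤, Subgroup.subtype _, fun x =>
    ⟨⟨x, trivial⟩, rfl⟩⟩
  exact Subtype.ext (Equiv.Perm.extendDomainHom_injective e (congrArg Subtype.val hxy))

theorem factorial_succ_le_pow {d m : ℕ} (h : m + 1 ≤ d) : (m + 1).factorial ≤ d ^ m := by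
  induction m with
  | zero => simp
  | succ m ih =>
    rw [Nat.factorial_succ, pow_succ']
    exact Nat.mul_le_mul h (ih (by omega))

theorem card_le_transBound_of_lt {d : ℕ} {X : Type*} [Finite X] (h2 : 2 ≤ Nat.card X)
    (hX : Nat.card X < d) (G : Subgroup (Equiv.Perm X)) :
    Nat.card G ≤ transBound d (Nat.card X) := by
  rw [transBound_of_two_le d h2]
  obtain ⟨m, hm⟩ : ∃ m, Nat.card X = m + 2 := ⟨Nat.card X - 2, by omega⟩
  calc Nat.card G ≤ Nat.card (Equiv.Perm X) := Subgroup.card_le_card_group G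
    _ = (m + 2) * (m + 1).factorial := by rw [Nat.card_perm, hm, Nat.factorial_succ]
    _ ≤ (d - 1) * d ^ m := Nat.mul_le_mul (by omega) (factorial_succ_le_pow (by omega))
    _ = _ := by rw [hm]; rfl

/-- Bochert's bound on the minimum size of a base. -/
theorem exists_base_two_mul_card_le {X : Type*} [Fintype X] [DecidableEq X]
    {G : Subgroup (Equiv.Perm X)} (hP : IsPreprimitive G X) (hA : ¬ alternatingGroup X ≤ G) :
    ∃ Δ : Finset X, 2 * Δ.card ≤ Nat.card X ∧ ∀ g ∈ G, (∀ x ∈ Δ, g x = x) → g = 1 := by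
  have hex : ∃ b, ∃ Δ : Finset X, Δ.card = b ∧ ∀ g ∈ G, (∀ x ∈ Δ, g x = x) → g = 1 :=
    ⟨_, Finset.univ, rfl, fun g _ hg => Equiv.ext fun x => hg x (Finset.mem_univ x)⟩
  classical
  obtain ⟨Δ, hcard, hbase⟩ := Nat.find_spec hex
  refine ⟨Δ, ?_, hbase⟩
  have hmin : ∀ S : Finset X, S.card < Δ.card → ∃ g ∈ G, (∀ x ∈ S, g x = x) ∧ g ≠ 1 := by
    intro S hS
    by_contra! hcon
    exact Nat.find_min hex (hcard ▸ hS) ⟨S, rfl, hcon⟩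
  by_contra! hlt
  obtain ⟨u, huG, hufix, hu1⟩ := hmin Δᶜ (by
    rw [Finset.card_compl, ← Nat.card_eq_fintype_card]; omega)
  obtain ⟨a, ha⟩ : ∃ a, u a ≠ a := by
    by_contra! hcon
    exact hu1 (Equiv.ext hcon)
  have haΔ : a ∈ Δ := by
    by_contra hcon
    exact ha (hufix a (Finset.mem_compl.mpr hcon))
  obtain ⟨v, hvG, hvfix, hv1⟩ := hmin (Δ.erase a) (Finset.card_erase_lt_of_mem haΔ)
  have hva : v a ≠ a := fun hva => hv1 (hbase v hvG fun x hx => by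
    by_cases hxa : x = a
    · rw [hxa, hva]
    · exact hvfix x (Finset.mem_erase.mpr ⟨hxa, hx⟩))
  refine hA (Equiv.Perm.alternatingGroup_le_of_isPreprimitive_of_isThreeCycle_mem hP
    (isThreeCycle_commutator ha hva fun x hux hvx => ?_)
    (G.mul_mem (G.mul_mem (G.mul_mem huG hvG) (G.inv_mem huG)) (G.inv_mem hvG)))
  by_contra hxa
  refine hvx (hvfix x (Finset.mem_erase.mpr ⟨hxa, ?_⟩))
  by_contra hx
  exact hux (hufix x (Finset.mem_compl.mpr hx))

theorem choose_le_two_pow_pred {n b : ℕ} (hb : 1 ≤ b) : n.choose b ≤ 2 ^ (n - 1) := by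
  rcases n with _ | n
  · rw [Nat.choose_eq_zero_of_lt (by omega)]; exact Nat.zero_le _
  obtain ⟨c, rfl⟩ : ∃ c, b = c + 1 := ⟨b - 1, by omega⟩
  rw [Nat.choose_succ_succ, Nat.add_sub_cancel, ← Nat.sum_range_choose]
  rcases Nat.lt_or_ge n (c + 1) with h | h
  · rw [Nat.choose_eq_zero_of_lt h, add_zero]
    rcases Nat.lt_or_ge n c with h' | h'
    · rw [Nat.choose_eq_zero_of_lt h']; exact Nat.zero_le _
    · exact Finset.single_le_sum (f := n.choose) (fun _ _ => Nat.zero_le _)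
        (Finset.mem_range.mpr (by omega))
  · calc n.choose c + n.choose (c + 1) = ∑ i ∈ {c, c + 1}, n.choose i :=
          (Finset.sum_pair (by omega)).symm
      _ ≤ _ := Finset.sum_le_sum_of_subset fun i hi => by
          simp only [Finset.mem_insert, Finset.mem_singleton] at hi
          exact Finset.mem_range.mpr (by omega)

theorem choose_mul_le_of_four_le {d n b s : ℕ} (hd : 4 ≤ d) (hb : 1 ≤ b) (hbn : 2 * b ≤ n)
    (hs : d * s ≤ d ^ b) : n.choose b * s ≤ (d - 1) * d ^ (n - 2) := by
  have h2C : 2 * n.choose b ≤ d ^ (n - b) :=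
    calc 2 * n.choose b ≤ 2 * 2 ^ (n - 1) := Nat.mul_le_mul_left _ (choose_le_two_pow_pred hb)
      _ = 2 ^ n := by rw [← pow_succ', Nat.sub_add_cancel (by omega)]
      _ ≤ 2 ^ (2 * (n - b)) := Nat.pow_le_pow_right (by omega) (by omega)
      _ = 4 ^ (n - b) := by rw [pow_mul]; norm_num
      _ ≤ d ^ (n - b) := Nat.pow_le_pow_left hd _
  have hdC : d * n.choose b ≤ (d - 1) * d ^ (n - b) :=
    calc d * n.choose b ≤ ((d - 1) * 2) * n.choose b := Nat.mul_le_mul_right _ (by omega)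
      _ = (d - 1) * (2 * n.choose b) := by ring
      _ ≤ _ := Nat.mul_le_mul_left _ h2C
  refine le_of_mul_le_mul_left ?_ (pow_pos (show 0 < d by omega) 2)
  calc d ^ 2 * (n.choose b * s) = (d * n.choose b) * (d * s) := by ring
    _ ≤ ((d - 1) * d ^ (n - b)) * d ^ b := Nat.mul_le_mul hdC hs
    _ = (d - 1) * d ^ ((n - b) + b) := by rw [pow_add]; ring
    _ = (d - 1) * d ^ (2 + (n - 2)) := by congr 2; omega
    _ = _ := by rw [pow_add]; ring

theorem TransitiveBound.card_le_of_four_le {d : ℕ} (hd : 4 ≤ d) {X : Type} [Finite X]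
    {G : Subgroup (Equiv.Perm X)} (hG : InGamma d G) (hP : IsPreprimitive G X)
    (h2 : 2 ≤ Nat.card X) (h : TransitiveBound d (Nat.card X)) :
    Nat.card G ≤ transBound d (Nat.card X) := by
  classical
  have := Fintype.ofFinite X
  rcases Nat.lt_or_ge (Nat.card X) d with hlt | hge
  · exact card_le_transBound_of_lt h2 hlt G
  have hA : ¬ alternatingGroup X ≤ G := fun hA => not_inGamma_alternatingGroup hge
    (hG.of_injective (Subgroup.inclusion hA) (Subgroup.inclusion_injective hA))
  obtain ⟨Δ, hΔ, hbase⟩ := exists_base_two_mul_card_le hP hA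
  rcases Nat.eq_zero_or_pos Δ.card with h0 | hpos
  · rw [Finset.card_eq_zero] at h0
    have : Subsingleton G := ⟨fun x y => Subtype.ext (by
      rw [hbase x x.2 (by simp [h0]), hbase y y.2 (by simp [h0])])⟩
    exact (Finite.card_le_one_iff_subsingleton.mpr this).trans (transBound_pos (by omega) _)
  set B : Set X := (Δ : Set X) with hB
  have hBcard : Nat.card B = Δ.card := by simp [hB]
  have hS : d * Nat.card (stabilizer G B) ≤ d ^ Δ.card := by
    have : FaithfulSMul (stabilizer G B) B := ⟨fun {x y} hxy => by
      have : ((x⁻¹ * y : stabilizer G B) : G) = 1 := Subtype.ext (hbase _ (SetLike.coe_mem _)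
        fun z hz => by
          have h1 := congrArg Subtype.val (hxy ⟨z, hz⟩)
          change (x : G) • z = (y : G) • z at h1
          change ((x : G)⁻¹ * (y : G)) • z = z
          rw [mul_smul, ← h1, inv_smul_smul])
      exact inv_mul_eq_one.mp (Subtype.ext this)⟩
    have h1 := h.pow_mul_card_le (by omega) (hG.subgroup (stabilizer G B)) (X := B) fun ω => by
      have : Nat.card ω.orbit ≤ Nat.card B := Finite.card_subtype_le _
      omega
    have : Nonempty B := (Finset.card_pos.mp hpos).to_subtype
    have : Nonempty (orbitRel.Quotient (stabilizer G B) B) := Nonempty.map Quotient.mk'' this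
    have hone : 1 ≤ Nat.card (orbitRel.Quotient (stabilizer G B) B) := Nat.card_pos
    rw [hBcard] at h1
    exact (Nat.mul_le_mul_right _ (Nat.le_self_pow (by omega) d)).trans h1
  have hidx : (stabilizer G B).index ≤ (Nat.card X).choose Δ.card := by
    have hsub : orbit G B ⊆ (fun s : Finset X => (s : Set X)) ''
        (Finset.powersetCard Δ.card Finset.univ : Finset (Finset X)) := by
      rintro _ ⟨g, rfl⟩
      refine ⟨g • Δ, ?_, by simp [hB]⟩
      simp [Finset.mem_powersetCard]
    rw [index_stabilizer]
    refine (Set.ncard_le_ncard hsub (Set.toFinite _)).trans ((Set.ncard_image_le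
      (Set.toFinite _)).trans ?_)
    rw [Set.ncard_coe_finset, Finset.card_powersetCard, Finset.card_univ, Nat.card_eq_fintype_card]
  rw [transBound_of_two_le d h2, ← (stabilizer G B).index_mul_card]
  exact (Nat.mul_le_mul_right _ hidx).trans (choose_mul_le_of_four_le hd hpos hΔ hS)

/-! ### Primitive groups for `d = 3` -/

/-- The pointwise stabilizer of the complement of `Q` is transitive on `Q`. -/
def IsJordanSet (G : Type*) {X : Type*} [Group G] [MulAction G X] (Q : Set X) : Prop :=
  ∀ x ∈ Q, ∀ y ∈ Q, ∃ g ∈ fixingSubgroup G Qᶜ, g • x = y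

theorem nine_mul_sq_le (s : ℕ) : 9 * s ^ 2 ≤ 4 * 3 ^ s := by
  rcases Nat.lt_or_ge s 2 with h | h
  · interval_cases s <;> norm_num
  · induction s, h using Nat.le_induction with
    | base => norm_num
    | succ k hk ih => rw [pow_succ 3 k]; nlinarith

theorem add_sq_mul_transBound_le {A c q : ℕ} (hq : 2 ≤ q) (hA : q ≤ A) (hc : c ≤ q) :
    (A + c) ^ 2 * transBound 3 c ≤ A ^ 2 * 3 ^ c := by
  rcases Nat.lt_or_ge c 2 with h | h
  · rw [transBound_of_le_one 3 (by omega)]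
    interval_cases c
    · simp
    · nlinarith
  · rw [transBound_of_two_le 3 h]
    obtain ⟨k, rfl⟩ : ∃ k, c = k + 2 := ⟨c - 2, by omega⟩
    have h1 : (A + (k + 2)) ^ 2 ≤ 4 * A ^ 2 := by
      calc (A + (k + 2)) ^ 2 ≤ (A + A) ^ 2 := Nat.pow_le_pow_left (by omega) 2
        _ = _ := by ring
    calc (A + (k + 2)) ^ 2 * ((3 - 1) * 3 ^ (k + 2 - 2))
        ≤ (4 * A ^ 2) * (2 * 3 ^ k) := Nat.mul_le_mul h1 le_rfl
      _ ≤ A ^ 2 * 3 ^ (k + 2) := by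
        rw [pow_add]
        have : 0 ≤ A ^ 2 * 3 ^ k := Nat.zero_le _
        nlinarith

theorem add_sum_sq_mul_prod_transBound_le {ι : Type*} (N : Finset ι) (c : ι → ℕ) {q : ℕ}
    (hq : 2 ≤ q) (hc : ∀ i ∈ N, c i ≤ q) :
    (q + ∑ i ∈ N, c i) ^ 2 * ∏ i ∈ N, transBound 3 (c i) ≤ q ^ 2 * 3 ^ ∑ i ∈ N, c i := by
  classical
  induction N using Finset.induction_on with
  | empty => simp
  | insert a N ha ih =>
    have ih := ih fun i hi => hc i (Finset.mem_insert_of_mem hi)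
    rw [Finset.sum_insert ha, Finset.prod_insert ha]
    calc (q + (c a + ∑ i ∈ N, c i)) ^ 2 * (transBound 3 (c a) * ∏ i ∈ N, transBound 3 (c i))
        = ((q + ∑ i ∈ N, c i + c a) ^ 2 * transBound 3 (c a)) * ∏ i ∈ N, transBound 3 (c i) := by
          ring
      _ ≤ ((q + ∑ i ∈ N, c i) ^ 2 * 3 ^ c a) * ∏ i ∈ N, transBound 3 (c i) :=
          Nat.mul_le_mul_right _ (add_sq_mul_transBound_le hq (by omega)
            (hc a (Finset.mem_insert_self a N)))
      _ = ((q + ∑ i ∈ N, c i) ^ 2 * ∏ i ∈ N, transBound 3 (c i)) * 3 ^ c a := by ring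
      _ ≤ (q ^ 2 * 3 ^ ∑ i ∈ N, c i) * 3 ^ c a := Nat.mul_le_mul_right _ ih
      _ = _ := by rw [pow_add]; ring

section

variable {G X : Type*} [Group G] [MulAction G X]

theorem smul_mem_iff_of_mem_fixingSubgroup_compl {A : Set X} {g : G}
    (hg : g ∈ fixingSubgroup G Aᶜ) {x : X} : g • x ∈ A ↔ x ∈ A := by
  rw [mem_fixingSubgroup_iff] at hg
  constructor
  · intro h
    by_contra hx
    exact hx (hg x hx ▸ h)
  · intro h
    by_contra hx
    exact hx ((smul_left_cancel g (hg _ hx)).symm ▸ h)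

end

theorem TransitiveBound.card_fixingSubgroup_compl_le {n : ℕ} (h : TransitiveBound 3 n)
    {G : Type*} {X : Type} [Group G] [Finite G] [Finite X] [MulAction G X] [FaithfulSMul G X]
    (hG : InGamma 3 G) (A : Set X) (hA : A.ncard < n)
    (hJ : ∀ Q ⊆ A, IsJordanSet G Q → Q.ncard ≤ 1) :
    9 * A.ncard ^ 2 * Nat.card (fixingSubgroup G Aᶜ) ≤ 4 * 3 ^ A.ncard := by
  classical
  induction hs : A.ncard using Nat.strong_induction_on generalizing A with
  | _ s ih =>
  subst hs
  set H := fixingSubgroup G Aᶜ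
  by_cases htriv : ∀ g ∈ H, ∀ x : X, g • x = x
  · have : Nat.card H ≤ 1 := Finite.card_le_one_iff_subsingleton.mpr ⟨fun g k =>
      Subtype.ext (FaithfulSMul.eq_of_smul_eq_smul fun x : X => by
        rw [htriv g g.2, htriv k k.2])⟩
    calc 9 * A.ncard ^ 2 * Nat.card H ≤ 9 * A.ncard ^ 2 * 1 := Nat.mul_le_mul_left _ this
      _ ≤ _ := by rw [mul_one]; exact nine_mul_sq_le _
  push Not at htriv
  obtain ⟨g₀, hg₀, x₀, hx₀⟩ := htriv
  have := Fintype.ofFinite X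
  have := Fintype.ofFinite (orbitRel.Quotient H X)
  let c : orbitRel.Quotient H X → ℕ := fun ω => (A ∩ ω.orbit).ncard
  have horb : ∀ x ∈ A, orbitRel.Quotient.orbit (Quotient.mk'' x : orbitRel.Quotient H X) ⊆ A := by
    rintro x hx y hy
    rw [orbitRel.Quotient.orbit_mk] at hy
    obtain ⟨g, rfl⟩ := hy
    exact (smul_mem_iff_of_mem_fixingSubgroup_compl g.2).mpr hx
  have hdich : ∀ ω : orbitRel.Quotient H X,
      (ω.orbit ⊆ A ∧ Nat.card ω.orbit = c ω) ∨ (c ω = 0 ∧ Nat.card ω.orbit = 1) := by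
    intro ω
    induction ω using Quotient.inductionOn' with
    | h x =>
      by_cases hx : x ∈ A
      · left
        refine ⟨horb x hx, ?_⟩
        simp only [c]
        rw [Set.inter_eq_right.mpr (horb x hx), Nat.card_coe_set_eq]
      · right
        have : orbitRel.Quotient.orbit (Quotient.mk'' x : orbitRel.Quotient H X) = {x} := by
          rw [orbitRel.Quotient.orbit_mk]
          ext y
          constructor
          · rintro ⟨g, rfl⟩
            exact (mem_fixingSubgroup_iff G).mp g.2 x hx
          · rintro rfl
            exact mem_orbit_self _
        simp only [c]
        rw [this]
        simp [hx]
  have hT : ∀ ω, transBound 3 (Nat.card ω.orbit) = transBound 3 (c ω) := by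
    intro ω
    rcases hdich ω with ⟨-, h1⟩ | ⟨h0, h1⟩
    · rw [h1]
    · rw [h1, h0, transBound_of_le_one 3 le_rfl, transBound_of_le_one 3 zero_le_one]
  have hsum : ∑ ω, c ω = A.ncard := by
    have := Finset.card_eq_sum_card_fiberwise (s := A.toFinset) (t := Finset.univ)
      (f := (Quotient.mk'' : X → orbitRel.Quotient H X))
      (fun _ _ => Finset.mem_coe.mpr (Finset.mem_univ _))
    rw [Set.ncard_eq_toFinset_card', this]
    refine Finset.sum_congr rfl fun ω _ => ?_
    simp only [c]
    rw [Set.ncard_eq_toFinset_card']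
    congr 1
    ext x
    simp [orbitRel.Quotient.mem_orbit]
  have : Nonempty (orbitRel.Quotient H X) := ⟨Quotient.mk'' x₀⟩
  obtain ⟨ω₀, hω₀⟩ := Finite.exists_max c
  set q := c ω₀ with hq
  have hq2 : 2 ≤ q := by
    refine le_trans ?_ (hω₀ (Quotient.mk'' x₀))
    have hx₀A : x₀ ∈ A := by
      by_contra hx
      exact hx₀ ((mem_fixingSubgroup_iff G).mp hg₀ x₀ hx)
    simp only [c]
    rw [Set.inter_eq_right.mpr (horb x₀ hx₀A), orbitRel.Quotient.orbit_mk]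
    exact (Set.one_lt_ncard_iff).mpr ⟨g₀ • x₀, x₀, ⟨⟨g₀, hg₀⟩, rfl⟩, mem_orbit_self _, hx₀⟩
  have hqQ : Nat.card ω₀.orbit = q ∧ ω₀.orbit ⊆ A := by
    rcases hdich ω₀ with ⟨h1, h2⟩ | ⟨h0, -⟩
    · exact ⟨h2, h1⟩
    · omega
  set Q : Set X := ω₀.orbit with hQ
  have hQcard : Q.ncard = q := by rw [← hqQ.1, Nat.card_coe_set_eq]
  have hQA : Q ≠ A := by
    intro hQA
    have := hJ A le_rfl (by
      intro x hx y hy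
      rw [← hQA] at hx hy
      obtain ⟨g, hg⟩ := exists_smul_eq H (⟨x, hx⟩ : ω₀.orbit) ⟨y, hy⟩
      exact ⟨g, g.2, congrArg Subtype.val hg⟩)
    rw [← hQA, hQcard] at this
    omega
  have hlt : Q.ncard < A.ncard := Set.ncard_lt_ncard (hqQ.2.ssubset_of_ne hQA)
  have ihQ := ih Q.ncard hlt Q (hlt.trans hA) (fun Q' hQ' => hJ Q' (hQ'.trans hqQ.2)) rfl
  have hcard := h.card_le_mul_prod_orbits (hG.subgroup H) (X := X) (Finset.univ.erase ω₀)
    (fun ω _ => by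
      rcases hdich ω with ⟨-, h1⟩ | ⟨-, h1⟩
      · have := hω₀ ω
        omega
      · omega) ((fixingSubgroup G Qᶜ).subgroupOf H) (fun g hg => by
      rw [Subgroup.mem_subgroupOf, mem_fixingSubgroup_iff]
      intro x hx
      refine hg (Quotient.mk'' x) (Finset.mem_erase.mpr ⟨?_, Finset.mem_univ _⟩) x ?_
      · rintro rfl
        exact hx (by rw [hQ, orbitRel.Quotient.orbit_mk]; exact mem_orbit_self x)
      · rw [orbitRel.Quotient.orbit_mk]; exact mem_orbit_self x)
  have hK : Nat.card ((fixingSubgroup G Qᶜ).subgroupOf H) ≤ Nat.card (fixingSubgroup G Qᶜ) :=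
    Nat.card_le_card_of_injective (fun k => ⟨k.1.1, k.2⟩) fun k l hkl =>
      by
      have hval := congrArg Subtype.val hkl
      exact Subtype.ext (Subtype.ext hval)
  simp only [hT] at hcard
  have hsum' : ∑ ω ∈ Finset.univ.erase ω₀, c ω + q = A.ncard := by
    rw [← hsum]
    exact Finset.sum_erase_add _ _ (Finset.mem_univ ω₀)
  have hprod := add_sum_sq_mul_prod_transBound_le (Finset.univ.erase ω₀) c hq2 fun ω _ => hω₀ ω
  rw [hQcard] at ihQ
  set P := ∏ ω ∈ Finset.univ.erase ω₀, transBound 3 (c ω)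
  set t := ∑ ω ∈ Finset.univ.erase ω₀, c ω
  rw [← hsum', add_comm t q]
  refine le_of_mul_le_mul_left ?_ (show 0 < q ^ 2 by positivity)
  calc q ^ 2 * (9 * (q + t) ^ 2 * Nat.card H)
      ≤ q ^ 2 * (9 * (q + t) ^ 2 * (Nat.card (fixingSubgroup G Qᶜ) * P)) :=
        Nat.mul_le_mul_left _ (Nat.mul_le_mul_left _
          (hcard.trans (Nat.mul_le_mul_right _ hK)))
    _ = (9 * q ^ 2 * Nat.card (fixingSubgroup G Qᶜ)) * ((q + t) ^ 2 * P) := by ring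
    _ ≤ (4 * 3 ^ q) * (q ^ 2 * 3 ^ t) := Nat.mul_le_mul ihQ hprod
    _ = q ^ 2 * (4 * 3 ^ (q + t)) := by rw [pow_add]; ring

section

variable {G X : Type*} [Group G] [MulAction G X]

theorem IsJordanSet.smul {Q : Set X} (hQ : IsJordanSet G Q) (g : G) : IsJordanSet G (g • Q) := by
  rintro _ ⟨x, hx, rfl⟩ _ ⟨y, hy, rfl⟩
  obtain ⟨k, hk, hkxy⟩ := hQ x hx y hy
  refine ⟨g * k * g⁻¹, (mem_fixingSubgroup_iff G).mpr fun z hz => ?_, ?_⟩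
  · have hz' : g⁻¹ • z ∈ Qᶜ := fun h => hz (Set.mem_smul_set_iff_inv_smul_mem.mpr h)
    rw [mul_smul, mul_smul, (mem_fixingSubgroup_iff G).mp hk _ hz', smul_inv_smul]
  · simp only [mul_smul, inv_smul_smul, hkxy]

theorem fixingSubgroup_compl_mono {A B : Set X} (h : A ⊆ B) :
    fixingSubgroup G Aᶜ ≤ fixingSubgroup G Bᶜ :=
  fixingSubgroup_antitone G X (Set.compl_subset_compl.mpr h)

theorem IsJordanSet.union {A B : Set X} (hA : IsJordanSet G A) (hB : IsJordanSet G B)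
    (hAB : (A ∩ B).Nonempty) : IsJordanSet G (A ∪ B) := by
  obtain ⟨z, hzA, hzB⟩ := hAB
  have hto : ∀ x ∈ A ∪ B, ∃ g ∈ fixingSubgroup G (A ∪ B)ᶜ, g • x = z := by
    rintro x (hx | hx)
    · obtain ⟨g, hg, hgx⟩ := hA x hx z hzA
      exact ⟨g, fixingSubgroup_compl_mono Set.subset_union_left hg, hgx⟩
    · obtain ⟨g, hg, hgx⟩ := hB x hx z hzB
      exact ⟨g, fixingSubgroup_compl_mono Set.subset_union_right hg, hgx⟩
  intro x hx y hy
  obtain ⟨g, hg, hgx⟩ := hto x hx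
  obtain ⟨k, hk, hky⟩ := hto y hy
  exact ⟨k⁻¹ * g, mul_mem (inv_mem hk) hg, by rw [mul_smul, hgx, inv_smul_eq_iff, hky]⟩

theorem ncard_orbit_dvd_card [Finite G] (x : X) : (orbit G x).ncard ∣ Nat.card G := by
  rw [← index_stabilizer]
  exact Subgroup.index_dvd_card _

theorem IsJordanSet.ncard_dvd_card [Finite G] {Q : Set X} (hQ : IsJordanSet G Q)
    (hne : Q.Nonempty) : Q.ncard ∣ Nat.card G := by
  obtain ⟨x, hx⟩ := hne
  have : orbit (fixingSubgroup G Qᶜ) x = Q := by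
    ext y
    constructor
    · rintro ⟨g, rfl⟩
      exact (smul_mem_iff_of_mem_fixingSubgroup_compl g.2).mpr hx
    · intro hy
      obtain ⟨g, hg, hgx⟩ := hQ x hx y hy
      exact ⟨⟨g, hg⟩, hgx⟩
  rw [← this]
  exact (ncard_orbit_dvd_card x).trans (Subgroup.card_subgroup_dvd_card _)

theorem ncard_offDiag [Finite X] (C : Set X) : C.offDiag.ncard = C.ncard * (C.ncard - 1) := by
  classical
  have := Fintype.ofFinite X
  rw [Set.ncard_eq_toFinset_card' C, ← Set.coe_toFinset C, ← Finset.coe_offDiag,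
    Set.ncard_coe_finset, Finset.offDiag_card, Nat.mul_sub_one]
  simp

theorem orbit_prod_eq_offDiag {C : Set X} (hinv : ∀ g : G, ∀ x ∈ C, g • x ∈ C)
    (htrans : ∀ a ∈ C, ∀ b ∈ C, ∀ a' ∈ C, ∀ b' ∈ C, a ≠ b → a' ≠ b' →
      ∃ g : G, g • a = a' ∧ g • b = b') {a b : X} (ha : a ∈ C) (hb : b ∈ C) (hab : a ≠ b) :
    orbit G (a, b) = C.offDiag := by
  ext ⟨x, y⟩
  rw [Set.mem_offDiag]
  constructor
  · rintro ⟨g, hg⟩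
    obtain ⟨rfl, rfl⟩ := Prod.mk.inj hg
    exact ⟨hinv g a ha, hinv g b hb, fun h => hab (smul_left_cancel g h)⟩
  · rintro ⟨hx, hy, hxy⟩
    obtain ⟨g, rfl, rfl⟩ := htrans a ha b hb x hx y hy hab hxy
    exact ⟨g, rfl⟩

theorem ncard_mul_pred_dvd_card [Finite G] [Finite X] {C : Set X} (hC : 2 ≤ C.ncard)
    (hinv : ∀ g : G, ∀ x ∈ C, g • x ∈ C)
    (htrans : ∀ a ∈ C, ∀ b ∈ C, ∀ a' ∈ C, ∀ b' ∈ C, a ≠ b → a' ≠ b' →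
      ∃ g : G, g • a = a' ∧ g • b = b') :
    C.ncard * (C.ncard - 1) ∣ Nat.card G := by
  obtain ⟨a, b, ha, hb, hab⟩ := (Set.one_lt_ncard_iff).mp hC
  rw [← ncard_offDiag, ← orbit_prod_eq_offDiag hinv htrans ha hb hab]
  exact ncard_orbit_dvd_card _

theorem mod_three_of_mul_pred_dvd {n N : ℕ} (h : n * (n - 1) ∣ N) (hN : ¬ 3 ∣ N) : n % 3 = 2 := by
  by_contra hn
  have h3 : 3 ∣ n ∨ 3 ∣ n - 1 := by omega
  rcases h3 with h3 | h3
  · exact hN ((h3.mul_right _).trans h)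
  · exact hN ((h3.mul_left _).trans h)

theorem not_three_dvd_card [Finite G] (hG : InGamma 3 G) : ¬ 3 ∣ Nat.card G := by
  intro h
  have : Fact (Nat.Prime 3) := ⟨Nat.prime_three⟩
  obtain ⟨g, hg⟩ := exists_prime_orderOf_dvd_card' 3 h
  have hA : Nat.card (alternatingGroup (Fin 3)) = 3 := by
    rw [nat_card_alternatingGroup]
    simp [Nat.factorial]
  let e := mulEquivOfPrimeCardEq ((Nat.card_zpowers g).trans hg) hA
  exact hG ⟨Subgroup.zpowers g, e.toMonoidHom, e.surjective⟩

/-- A maximal Jordan set with at most `m` points. -/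
theorem exists_maximal_isJordanSet [Finite X] {m : ℕ} {Q : Set X} (hQ : IsJordanSet G Q)
    (hQm : Q.ncard ≤ m) : ∃ S : Set X, IsJordanSet G S ∧ Q.ncard ≤ S.ncard ∧ S.ncard ≤ m ∧
      ∀ g : G, (S ∩ g • S).Nonempty → (S ∪ g • S).ncard ≤ m → g • S = S := by
  obtain ⟨S, ⟨hSJ, hSm⟩, hmax⟩ := Set.exists_max_image {S : Set X | IsJordanSet G S ∧ S.ncard ≤ m}
    Set.ncard (Set.toFinite _) ⟨Q, hQ, hQm⟩
  refine ⟨S, hSJ, hmax Q ⟨hQ, hQm⟩, hSm, fun g hne hcard => ?_⟩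
  have h1 := hmax _ ⟨hSJ.union (hSJ.smul g) hne, hcard⟩
  have h2 : S = S ∪ g • S := Set.eq_of_subset_of_ncard_le Set.subset_union_left h1
  refine Set.eq_of_subset_of_ncard_le (Set.union_eq_left.mp h2.symm) ?_
  rw [Set.ncard_smul_set]

theorem isMultiplyPretransitive_two_of_isJordanSet_compl_singleton [IsPretransitive G X] {x : X}
    (hx : IsJordanSet G ({x}ᶜ : Set X)) : IsMultiplyPretransitive G X 2 := by
  rw [is_two_pretransitive_iff]
  intro a b c d hab hcd
  have hc : IsJordanSet G ({c}ᶜ : Set X) := by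
    obtain ⟨g, rfl⟩ := exists_smul_eq G x c
    have := hx.smul g
    rwa [Set.smul_set_compl, Set.smul_set_singleton] at this
  obtain ⟨g, rfl⟩ := exists_smul_eq G a c
  obtain ⟨k, hk, hkb⟩ := hc (g • b) (fun h => hab (smul_left_cancel g h).symm) d hcd.symm
  rw [compl_compl, mem_fixingSubgroup_iff] at hk
  exact ⟨k * g, by rw [mul_smul, hk _ rfl], by rw [mul_smul, hkb]⟩

theorem isMultiplyPretransitive_two_of_isJordanSet [Finite X] [IsPreprimitive G X] {Q : Set X}
    (hQ : IsJordanSet G Q) (hQ2 : 2 ≤ Q.ncard) (hQn : Q.ncard < Nat.card X) :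
    IsMultiplyPretransitive G X 2 := by
  obtain ⟨S, hSJ, hQS, hSn, hmax⟩ := exists_maximal_isJordanSet hQ (Nat.le_sub_one_of_lt hQn)
  have htri : ∀ g : G, g • S = S ∨ Disjoint (g • S) S ∨ S ∪ g • S = Set.univ := by
    intro g
    by_cases hne : (S ∩ g • S).Nonempty
    · by_cases hcard : (S ∪ g • S).ncard ≤ Nat.card X - 1
      · exact Or.inl (hmax g hne hcard)
      · refine Or.inr (Or.inr (Set.eq_of_subset_of_ncard_le (Set.subset_univ _) ?_))
        rw [Set.ncard_univ]
        omega
    · refine Or.inr (Or.inl ?_)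
      rw [Set.disjoint_iff_inter_eq_empty, Set.inter_comm]
      exact Set.not_nonempty_iff_eq_empty.mp hne
  have hadd : ∀ g : G, (S ∪ g • S).ncard + (S ∩ g • S).ncard = 2 * S.ncard := fun g => by
    rw [Set.ncard_union_add_ncard_inter, Set.ncard_smul_set, two_mul]
  have hcompl := Set.ncard_add_ncard_compl S
  rcases Nat.lt_or_ge (Nat.card X) (2 * S.ncard) with hlt | hge
  · have hblock : IsBlock G Sᶜ := by
      rw [isBlock_iff_smul_eq_or_disjoint]
      intro g
      rcases htri g with h | h | h
      · left
        rw [Set.smul_set_compl, h]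
      · exfalso
        have h1 := hadd g
        rw [Set.inter_comm, Set.disjoint_iff_inter_eq_empty.mp h, Set.ncard_empty] at h1
        have h2 : (S ∪ g • S).ncard ≤ Nat.card X := by
          rw [← Set.ncard_univ]
          exact Set.ncard_le_ncard (Set.subset_univ _)
        omega
      · right
        rw [Set.smul_set_compl, Set.disjoint_iff_inter_eq_empty, ← Set.compl_union,
          Set.union_comm, h, Set.compl_univ]
    rcases IsPreprimitive.isTrivialBlock_of_isBlock hblock with h | h
    · have h1 : Sᶜ.ncard = 1 := by
        have := Set.ncard_le_one_iff_subsingleton.mpr h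
        omega
      obtain ⟨x, hx⟩ := Set.ncard_eq_one.mp h1
      refine isMultiplyPretransitive_two_of_isJordanSet_compl_singleton (x := x) ?_
      rwa [← hx, compl_compl]
    · rw [h, Set.ncard_univ] at hcompl
      omega
  · have hblock : IsBlock G S := by
      rw [isBlock_iff_smul_eq_or_disjoint]
      intro g
      rcases htri g with h | h | h
      · exact Or.inl h
      · exact Or.inr h
      · right
        have h1 := hadd g
        rw [h, Set.ncard_univ] at h1
        rw [Set.disjoint_iff_inter_eq_empty, Set.inter_comm, ← Set.ncard_eq_zero]
        omega
    rcases IsPreprimitive.isTrivialBlock_of_isBlock hblock with h | h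
    · have := Set.ncard_le_one_iff_subsingleton.mpr h
      omega
    · rw [h, Set.ncard_univ] at hSn
      omega

theorem card_mod_three [Finite G] [Finite X] (hG : ¬ 3 ∣ Nat.card G)
    (h2 : IsMultiplyPretransitive G X 2) (hX : 2 ≤ Nat.card X) : Nat.card X % 3 = 2 := by
  rw [is_two_pretransitive_iff] at h2
  have := ncard_mul_pred_dvd_card (G := G) (C := (Set.univ : Set X)) (by rwa [Set.ncard_univ])
    (fun _ _ _ => trivial) fun a _ b _ a' _ b' _ => h2
  rw [Set.ncard_univ] at this
  exact mod_three_of_mul_pred_dvd this hG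

theorem not_isJordanSet_of_not_three_dvd_card [Finite G] [Finite X] (hG : ¬ 3 ∣ Nat.card G)
    (h2 : IsMultiplyPretransitive G X 2) {Q : Set X} (hQ2 : 2 ≤ Q.ncard)
    (hQn : Q.ncard + 2 ≤ Nat.card X) : ¬ IsJordanSet G Q := by
  intro hQ
  have hmod := card_mod_three hG h2 (by omega)
  rw [is_two_pretransitive_iff] at h2
  obtain ⟨S, hSJ, hQS, hSn, hmax⟩ := exists_maximal_isJordanSet hQ (Nat.le_sub_of_add_le hQn)
  have hadd : ∀ g : G, (S ∪ g • S).ncard + (S ∩ g • S).ncard = 2 * S.ncard := fun g => by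
    rw [Set.ncard_union_add_ncard_inter, Set.ncard_smul_set, two_mul]
  have hcompl := Set.ncard_add_ncard_compl S
  have hlarge : Nat.card X < 2 * S.ncard + 2 := by
    by_contra! hsmall
    obtain ⟨a, b, ha, hb, hab⟩ := (Set.one_lt_ncard_iff).mp (hQ2.trans hQS)
    obtain ⟨c, hc⟩ : Sᶜ.Nonempty := Set.nonempty_of_ncard_ne_zero (by omega)
    obtain ⟨g, hga, hgb⟩ := h2 hab (show a ≠ c from fun h => hc (h ▸ ha))
    have hcS : c ∈ g • S := hgb ▸ Set.smul_mem_smul_set hb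
    refine hc ((hmax g ⟨a, ha, ?_⟩ ?_) ▸ hcS)
    · exact Set.mem_smul_set.mpr ⟨a, ha, hga⟩
    · have := hadd g
      omega
  have hstab : ∀ g : G, ∀ a ∈ Sᶜ, ∀ b ∈ Sᶜ, a ≠ b → g • a ∈ Sᶜ → g • b ∈ Sᶜ → g • S = S := by
    intro g a ha b hb hab hga hgb
    have hsub : ({g • a, g • b} : Set X) ⊆ (S ∪ g • S)ᶜ := by
      rw [Set.compl_union, ← Set.smul_set_compl]
      rintro _ (rfl | rfl)
      · exact ⟨hga, Set.smul_mem_smul_set ha⟩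
      · exact ⟨hgb, Set.smul_mem_smul_set hb⟩
    have h1 := Set.ncard_le_ncard hsub
    rw [Set.ncard_pair (fun h => hab (smul_left_cancel g h))] at h1
    have h3 := Set.ncard_add_ncard_compl (S ∪ g • S)
    have h4 := hadd g
    exact hmax g (Set.nonempty_of_ncard_ne_zero (by omega)) (by omega)
  have hdvd := ncard_mul_pred_dvd_card (G := stabilizer G S) (C := Sᶜ) (by omega)
    (fun g x hx => by
      have h1 : (g : G) • S = S := g.2
      have h3 : (g : G) • x ∈ (g : G) • Sᶜ := Set.smul_mem_smul_set hx
      rwa [Set.smul_set_compl, h1] at h3)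
    (fun a ha b hb a' ha' b' hb' hab hab' => by
      obtain ⟨g, rfl, rfl⟩ := h2 hab hab'
      exact ⟨⟨g, hstab g a ha b hb hab ha' hb'⟩, rfl, rfl⟩)
  have hC := mod_three_of_mul_pred_dvd hdvd fun h =>
    hG (h.trans (Subgroup.card_subgroup_dvd_card _))
  refine hG (dvd_trans ?_ (hSJ.ncard_dvd_card (Set.nonempty_of_ncard_ne_zero (by omega))))
  omega

end

theorem TransitiveBound.card_le_of_three {X : Type} [Finite X] {G : Subgroup (Equiv.Perm X)}
    (hG : InGamma 3 G) (hP : IsPreprimitive G X) (h2 : 2 ≤ Nat.card X)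
    (h : TransitiveBound 3 (Nat.card X)) : Nat.card G ≤ transBound 3 (Nat.card X) := by
  rcases h2.eq_or_lt with h2' | h3
  · exact card_le_transBound_of_lt h2 (by omega) G
  have h3dvd := not_three_dvd_card hG
  rw [transBound_of_two_le 3 h2]
  by_cases hT : IsMultiplyPretransitive G X 2
  · have hmod := card_mod_three h3dvd hT h2
    obtain ⟨m, hm⟩ : ∃ m, Nat.card X = m + 3 := ⟨Nat.card X - 3, by omega⟩
    obtain ⟨x, y, hx, hy, hxy⟩ :=
      (Set.one_lt_ncard_iff (s := (Set.univ : Set X))).mp (by rw [Set.ncard_univ]; omega)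
    have hcompl := Set.ncard_add_ncard_compl ({x, y} : Set X)
    rw [Set.ncard_pair hxy] at hcompl
    have hcard : ({x, y}ᶜ : Set X).ncard = m + 1 := by omega
    have hkey := h.card_fixingSubgroup_compl_le hG ({x, y}ᶜ : Set X) (by omega) fun Q hQ hQJ => by
      by_contra! hQ1
      have := Set.ncard_le_ncard hQ
      exact not_isJordanSet_of_not_three_dvd_card h3dvd hT hQ1 (by omega) hQJ
    rw [hcard, compl_compl] at hkey
    have hstab : stabilizer G (x, y) ≤ fixingSubgroup G ({x, y} : Set X) := by
      intro g hg
      obtain ⟨h1, h1'⟩ := Prod.mk.inj (mem_stabilizer_iff.mp hg)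
      rw [mem_fixingSubgroup_iff]
      rintro _ (rfl | rfl)
      · exact h1
      · exact h1'
    have hidx : (stabilizer G (x, y)).index = (m + 3) * (m + 2) := by
      rw [is_two_pretransitive_iff] at hT
      rw [index_stabilizer, orbit_prod_eq_offDiag (C := Set.univ) (fun _ _ _ => trivial)
        (fun a _ b _ a' _ b' _ => hT) hx hy hxy, ncard_offDiag, Set.ncard_univ, hm]
      rfl
    have hle := Subgroup.card_le_of_le hstab
    rw [← (stabilizer G (x, y)).index_mul_card, hidx, hm, show m + 3 - 2 = m + 1 by omega]
    rw [pow_succ 3 m] at hkey ⊢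
    set k := Nat.card (fixingSubgroup G ({x, y} : Set X))
    calc (m + 3) * (m + 2) * Nat.card (stabilizer G (x, y)) ≤ (m + 3) * (m + 2) * k :=
          Nat.mul_le_mul_left _ hle
      _ ≤ (3 - 1) * (3 ^ m * 3) := by
          have h4 : 2 * ((m + 3) * (m + 2)) ≤ 9 * (m + 1) ^ 2 := by
            have : 2 ≤ m := by omega
            nlinarith
          have := Nat.mul_le_mul_right k h4
          nlinarith
  · obtain ⟨m, hm⟩ : ∃ m, Nat.card X = m + 2 := ⟨Nat.card X - 2, by omega⟩
    obtain ⟨x⟩ : Nonempty X := (Nat.card_pos_iff.mp (by omega)).1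
    have hcompl := Set.ncard_add_ncard_compl ({x} : Set X)
    rw [Set.ncard_singleton] at hcompl
    have hcard : ({x}ᶜ : Set X).ncard = m + 1 := by omega
    have hkey := h.card_fixingSubgroup_compl_le hG ({x}ᶜ : Set X) (by omega) fun Q hQ hQJ => by
      by_contra! hQ1
      have := Set.ncard_le_ncard hQ
      exact hT (isMultiplyPretransitive_two_of_isJordanSet hQJ hQ1 (by omega))
    rw [hcard, compl_compl] at hkey
    have hstab : stabilizer G x ≤ fixingSubgroup G ({x} : Set X) := by
      intro g hg
      rw [mem_fixingSubgroup_iff]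
      rintro _ rfl
      exact hg
    have hle := Subgroup.card_le_of_le hstab
    rw [← (stabilizer G x).index_mul_card, index_stabilizer_of_transitive, hm,
      show m + 2 - 2 = m by omega]
    rw [pow_succ 3 m] at hkey
    set k := Nat.card (fixingSubgroup G ({x} : Set X))
    calc (m + 2) * Nat.card (stabilizer G x) ≤ (m + 2) * k := Nat.mul_le_mul_left _ hle
      _ ≤ (3 - 1) * 3 ^ m := by
          have h4 : 2 * (m + 2) ≤ 3 * (m + 1) ^ 2 := by
            have : 1 ≤ m := by omega
            nlinarith
          have := Nat.mul_le_mul_right k h4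
          nlinarith

/-! ### The main theorem -/

theorem transitiveBound {d : ℕ} (hd : 3 ≤ d) (n : ℕ) : TransitiveBound d n := by
  refine transitiveBound_of_preprimitive (by omega) (fun X _ G hG hP h2 h => ?_) n
  rcases hd.eq_or_lt with rfl | hd
  · exact h.card_le_of_three hG hP h2
  · exact h.card_le_of_four_le hd hG hP h2

/-- **Lemma 2.2 (after Babai–Cameron–Pálfy).** If `d ≥ 2` and `G ≤ Sym(Ω)` is a permutation
group of degree `n = |Ω| ≥ 2` with `G ∈ Γ_d`, then `|G| < d^{n-1}`. -/
theorem order_lt_pow_of_in_gamma (d : ℕ) (hd : 2 ≤ d)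
    (Ω : Type) [Fintype Ω] (hn : 2 ≤ Fintype.card Ω)
    (G : Subgroup (Equiv.Perm Ω)) (hG : InGamma d ↥G) :
    Nat.card ↥G < d ^ (Fintype.card Ω - 1) := by
  rcases hd.eq_or_lt with rfl | hd3
  · exact absurd hG (not_inGamma_two G)
  rw [← Nat.card_eq_fintype_card] at hn ⊢
  by_cases hT : IsPretransitive G Ω
  · exact (transitiveBound hd3 _ Ω G hG hT (Nat.lt_succ_self _)).trans_lt (transBound_lt hd hn)
  have : Nonempty Ω := (Nat.card_pos_iff.mp (by omega)).1
  have horb : 2 ≤ Nat.card (orbitRel.Quotient G Ω) := by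
    by_contra! hlt
    have hsub := Finite.card_le_one_iff_subsingleton.mp (Nat.lt_succ_iff.mp hlt)
    exact hT ((pretransitive_iff_subsingleton_quotient G Ω).mpr hsub)
  have h := (transitiveBound hd3 (Nat.card Ω + 1)).pow_mul_card_le hd hG (X := Ω) fun ω =>
    Nat.lt_succ_of_le (Finite.card_subtype_le _)
  refine lt_of_mul_lt_mul_left ?_ (Nat.zero_le (d ^ 2))
  calc d ^ 2 * Nat.card G ≤ d ^ Nat.card (orbitRel.Quotient G Ω) * Nat.card G :=
        Nat.mul_le_mul_right _ (Nat.pow_le_pow_right (by omega) horb)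
    _ ≤ d ^ Nat.card Ω := h
    _ < d ^ (2 + (Nat.card Ω - 1)) := Nat.pow_lt_pow_right (by omega) (by omega)
    _ = _ := pow_add _ _ _
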